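/- arXiv:1409.0699 — 3 statements merged into one kernel-verified Lean document; each statement's English description precedes it below -/
import Mathlib

section
/- Half-degree principle: Let f ∈ ℝ[X_1,…,X_n] be a symmetric polynomial of total degree d ≥ 1, and set k := max{2, ⌊d/2⌋}. Then f(y) ≥ 0 for all y ∈ ℝ^n if and only if f(ỹ) ≥ 0 for all ỹ ∈ A_k, i.e., for all points of ℝ^n having at most k distinct coordinates. -/
open MvPolynomial

lemma Polynomial.eventually_splits_prod_X_sub_C_add_C (S : Finset ℝ) :
    ∀ᶠ c in nhds (0 : ℝ), (∏ s ∈ S, (Polynomial.X - Polynomial.C s) + Polynomial.C c).Splits := by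
  set A : Polynomial ℝ := ∏ s ∈ S, (Polynomial.X - Polynomial.C s) with hA
  have hdegA : A.natDegree = S.card := by simp [hA]
  obtain ⟨U, hU, hdisj⟩ := S.finite_toSet.t2_separation
  have hev : ∀ᶠ c in nhds (0 : ℝ), ∀ s ∈ S, -c ∈ (fun t => A.eval t) '' U s := by
    rw [Filter.eventually_all_finset]
    intro s hs
    have h0 : A.eval s = 0 := by
      rw [hA, Polynomial.eval_prod]
      exact Finset.prod_eq_zero hs (by simp)
    have hsep : A.Separable := Polynomial.separable_prod_X_sub_C_iff'.2 (by simp)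
    have hd : A.derivative.eval s ≠ 0 := hsep.eval₂_derivative_ne_zero (RingHom.id ℝ) h0
    have hmap := (A.hasStrictDerivAt s).map_nhds_eq hd
    have himg : (fun t => A.eval t) '' U s ∈ nhds (A.eval s) :=
      hmap ▸ Filter.image_mem_map ((hU s).2.mem_nhds (hU s).1)
    rw [h0] at himg
    have hneg : Filter.Tendsto (fun c : ℝ => -c) (nhds 0) (nhds 0) := by
      simpa using (continuous_neg (G := ℝ)).tendsto 0
    exact hneg himg
  filter_upwards [hev] with c hc
  have hdeg : (A + Polynomial.C c).natDegree = S.card := by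
    rw [Polynomial.natDegree_add_C, hdegA]
  rw [Polynomial.splits_iff_card_roots]
  refine le_antisymm (Polynomial.card_roots' _) ?_
  rcases S.eq_empty_or_nonempty with rfl | hne
  · simp [hdeg]
  have hne0 : A + Polynomial.C c ≠ 0 := by
    intro h
    rw [h, Polynomial.natDegree_zero] at hdeg
    exact hne.card_pos.ne hdeg
  choose! ρ hρU hρ using hc
  have hinj : Set.InjOn ρ S := by
    intro s hs t ht hst
    by_contra hne
    exact Set.disjoint_left.1 (hdisj hs ht hne) (hρU s hs) (hst ▸ hρU t ht)
  rw [hdeg, ← Finset.card_image_of_injOn hinj]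
  refine le_trans (Finset.card_le_card ?_) (Multiset.toFinset_card_le _)
  intro t ht
  obtain ⟨s, hs, rfl⟩ := Finset.mem_image.1 ht
  have := hρ s hs
  simp only at this
  simp [hne0, this]

lemma Polynomial.Splits.exists_eq_prod_X_add_C {R : Type*} [CommRing R] [IsDomain R]
    {p : Polynomial R} (hp : p.Splits) (hm : p.Monic) {n : ℕ} (hn : p.natDegree = n) :
    ∃ z : Fin n → R, p = ∏ i, (Polynomial.X + Polynomial.C (z i)) := by
  have hcard : p.roots.toList.length = n := by
    rw [Multiset.length_toList, ← hp.natDegree_eq_card_roots, hn]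
  subst hcard
  refine ⟨fun i => -p.roots.toList.get i, ?_⟩
  conv_lhs => rw [hp.eq_prod_roots_of_monic hm]
  conv_lhs => rw [← Multiset.coe_toList p.roots]
  rw [Multiset.map_coe, Multiset.prod_coe]
  simp only [map_neg, ← sub_eq_add_neg]
  rw [← List.prod_ofFn]
  congr 1
  apply List.ext_get <;> simp

namespace MvPolynomial

lemma eval_esymm_eq_coeff {R : Type*} [CommRing R] {n : ℕ} (z : Fin n → R) {i : ℕ} (hi : i ≤ n) :
    eval z (esymm (Fin n) R i) =
      (∏ j, (Polynomial.X + Polynomial.C (z j))).coeff (n - i) := by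
  rw [Finset.prod_X_add_C_coeff _ _ (by simp)]
  simp [esymm, Nat.sub_sub_self hi]

lemma esymm_eq_zero {R : Type*} [CommRing R] {n i : ℕ} (hi : n < i) :
    esymm (Fin n) R i = 0 := by
  rw [esymm, Finset.powersetCard_eq_empty.2 (by simpa), Finset.sum_empty]

lemma isHomogeneous_esymm (σ R : Type*) [Fintype σ] [CommSemiring R] (i : ℕ) :
    (esymm σ R i).IsHomogeneous i := by
  refine IsHomogeneous.sum _ _ _ fun t ht => ?_
  have := IsHomogeneous.prod t (fun j => (X j : MvPolynomial σ R)) (fun _ => 1)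
    fun j _ => isHomogeneous_X R j
  simpa [(Finset.mem_powersetCard.1 ht).2] using this

lemma sum_sq_eq_esymm {R : Type*} [CommRing R] {n : ℕ} (z : Fin n → R) :
    ∑ i, z i ^ 2 =
      eval z (esymm (Fin n) R 1) ^ 2 - 2 * eval z (esymm (Fin n) R 2) := by
  have h := congrArg (eval z) (psum_eq_mul_esymm_sub_sum (Fin n) R 2 (by norm_num))
  have : (Finset.HasAntidiagonal.antidiagonal 2).filter
      (fun a : ℕ × ℕ => a.1 ∈ Set.Ioo 0 2) = {(1, 1)} := by
    ext ⟨a, b⟩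
    simp
    omega
  rw [this] at h
  simp [psum, esymm_one] at h ⊢
  rw [h]
  ring

lemma exists_esymm_perturbation {n k : ℕ} (x : Fin n → ℝ) (hk : k < (Set.range x).ncard) :
    ∃ u v : Fin n → ℝ,
      (∀ i, eval u (esymm (Fin n) ℝ i) + eval v (esymm (Fin n) ℝ i) =
        2 * eval x (esymm (Fin n) ℝ i)) ∧
      (∀ i ≤ k, eval u (esymm (Fin n) ℝ i) = eval x (esymm (Fin n) ℝ i)) ∧
      ∃ i, eval u (esymm (Fin n) ℝ i) ≠ eval x (esymm (Fin n) ℝ i) := by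
  classical
  set S : Finset ℝ := Finset.univ.image fun i => -x i with hS
  have hScard : S.card = (Set.range x).ncard := by
    rw [← Set.ncard_coe_finset, hS, Finset.coe_image, Finset.coe_univ, Set.image_univ,
      ← Set.ncard_image_of_injective _ neg_injective, ← Set.range_comp]
    congr 2
    ext i
    simp
  set P : Polynomial ℝ := ∏ j, (Polynomial.X + Polynomial.C (x j)) with hP
  set A : Polynomial ℝ := ∏ s ∈ S, (Polynomial.X - Polynomial.C s) with hA
  have hPm : P.Monic := Polynomial.monic_prod_of_monic _ _ fun i _ => Polynomial.monic_X_add_C _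
  have hAm : A.Monic := Polynomial.monic_prod_of_monic _ _ fun i _ => Polynomial.monic_X_sub_C _
  have hPdeg : P.natDegree = n := by
    rw [hP, Polynomial.natDegree_prod_of_monic _ _ fun i _ => Polynomial.monic_X_add_C _]
    simp
  have hAdeg : A.natDegree = S.card := by simp [hA]
  have hPs : P.Splits := Polynomial.Splits.prod fun i _ => Polynomial.Splits.X_add_C _
  obtain ⟨B, hB⟩ : A ∣ P := by
    refine Finset.prod_dvd_of_coprime ?_ ?_
    · exact fun a _ b _ hab => Polynomial.pairwise_coprime_X_sub_C Function.injective_id hab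
    · intro s hs
      obtain ⟨i, hi, rfl⟩ := Finset.mem_image.1 hs
      rw [map_neg, sub_neg_eq_add]
      exact Finset.dvd_prod_of_mem (fun j => Polynomial.X + Polynomial.C (x j)) hi
  have hBm : B.Monic := hAm.of_mul_monic_left (hB ▸ hPm)
  have hBs : B.Splits := hPs.of_dvd hPm.ne_zero (hB ▸ dvd_mul_left B A)
  have hBdeg : S.card + B.natDegree = n := by
    rw [← hPdeg, hB, hAm.natDegree_mul hBm, hAdeg]
  have hev := Polynomial.eventually_splits_prod_X_sub_C_add_C S
  have hneg : Filter.Tendsto (fun c : ℝ => -c) (nhds 0) (nhds 0) := by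
    simpa using (continuous_neg (G := ℝ)).tendsto 0
  obtain ⟨c, ⟨hc₁, hc₂⟩, hc₀⟩ : ∃ c : ℝ, ((A + Polynomial.C c).Splits ∧
      (A + Polynomial.C (-c)).Splits) ∧ c ≠ 0 :=
    (((hev.and (hneg.eventually hev)).filter_mono nhdsWithin_le_nhds).and
      (self_mem_nhdsWithin (a := (0 : ℝ)) (s := {0}ᶜ))).exists
  have key : ∀ e : ℝ, (A + Polynomial.C e).Splits → ∃ z : Fin n → ℝ,
      P + Polynomial.C e * B = ∏ i, (Polynomial.X + Polynomial.C (z i)) := by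
    intro e he
    have hlt : (Polynomial.C e).degree < A.degree := by
      refine Polynomial.degree_C_le.trans_lt ?_
      rw [← Polynomial.natDegree_pos_iff_degree_pos, hAdeg]
      omega
    have hm : (A + Polynomial.C e).Monic := hAm.add_of_left hlt
    have hd : (A + Polynomial.C e).natDegree = S.card := by
      rw [Polynomial.natDegree_add_C, hAdeg]
    have : P + Polynomial.C e * B = (A + Polynomial.C e) * B := by rw [hB]; ring
    rw [this]
    exact (he.mul hBs).exists_eq_prod_X_add_C (hm.mul hBm)
      (by rw [hm.natDegree_mul hBm, hd, hBdeg])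
  obtain ⟨u, hu⟩ := key c hc₁
  obtain ⟨v, hv⟩ := key (-c) hc₂
  have hu' : ∀ i ≤ n, eval u (esymm (Fin n) ℝ i) =
      eval x (esymm (Fin n) ℝ i) + c * B.coeff (n - i) := by
    intro i hi
    rw [eval_esymm_eq_coeff _ hi, eval_esymm_eq_coeff _ hi, ← hu]
    simp [← hP]
  have hv' : ∀ i ≤ n, eval v (esymm (Fin n) ℝ i) =
      eval x (esymm (Fin n) ℝ i) - c * B.coeff (n - i) := by
    intro i hi
    rw [eval_esymm_eq_coeff _ hi, eval_esymm_eq_coeff _ hi, ← hv]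
    simp [← hP, sub_eq_add_neg]
  refine ⟨u, v, fun i => ?_, fun i hi => ?_, n - B.natDegree, ?_⟩
  · rcases le_or_gt i n with hi | hi
    · rw [hu' i hi, hv' i hi]
      ring
    · simp [esymm_eq_zero hi]
  · rw [hu' i (by omega), Polynomial.coeff_eq_zero_of_natDegree_lt (by omega)]
    simp
  · rw [hu' _ (by omega), Nat.sub_sub_self (by omega), hBm.coeff_natDegree]
    simpa using hc₀

lemma prod_pow_add_prod_pow {n k : ℕ} {m : Fin n →₀ ℕ}
    (hm : ∑ i : Fin n, ((i : ℕ) + 1) * m i < 2 * (k + 1)) {a b c : Fin n → ℝ}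
    (hac : ∀ i, a i + c i = 2 * b i) (ha : ∀ i : Fin n, (i : ℕ) + 1 ≤ k → a i = b i) :
    ∏ i, a i ^ m i + ∏ i, c i ^ m i = 2 * ∏ i, b i ^ m i := by
  have hc : ∀ i : Fin n, (i : ℕ) + 1 ≤ k → c i = b i := fun i hi => by
    linarith [hac i, ha i hi]
  by_cases h : ∀ i : Fin n, k < (i : ℕ) + 1 → m i = 0
  · have aux : ∀ g : Fin n → ℝ, (∀ i : Fin n, (i : ℕ) + 1 ≤ k → g i = b i) →
        ∏ i, g i ^ m i = ∏ i, b i ^ m i := fun g hg => Finset.prod_congr rfl fun i _ => by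
      rcases le_or_gt ((i : ℕ) + 1) k with hi | hi
      · rw [hg i hi]
      · simp [h i hi]
    rw [aux a ha, aux c hc]
    ring
  · push Not at h
    obtain ⟨j, hj, hmj⟩ := h
    have hsum := Finset.add_sum_erase Finset.univ (fun i : Fin n => ((i : ℕ) + 1) * m i)
      (Finset.mem_univ j)
    have hmj1 : m j = 1 := by
      by_contra hne
      have hprod := Nat.mul_le_mul (Nat.succ_le_of_lt hj) (show 2 ≤ m j by omega)
      have := Nat.zero_le (∑ i ∈ Finset.univ.erase j, ((i : ℕ) + 1) * m i)
      linarith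
    have h0 : ∀ i ∈ Finset.univ.erase j, k < (i : ℕ) + 1 → m i = 0 := by
      intro i hi hik
      by_contra hne
      have h1 : 1 ≤ m i := by omega
      have h2 := Finset.single_le_sum (f := fun i : Fin n => ((i : ℕ) + 1) * m i)
        (fun _ _ => Nat.zero_le _) hi
      have hprod := Nat.mul_le_mul (Nat.succ_le_of_lt hik) h1
      rw [hmj1] at hsum
      linarith
    have aux : ∀ g : Fin n → ℝ, (∀ i : Fin n, (i : ℕ) + 1 ≤ k → g i = b i) →
        ∏ i, g i ^ m i = g j * ∏ i ∈ Finset.univ.erase j, b i ^ m i := fun g hg => by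
      rw [← Finset.mul_prod_erase _ _ (Finset.mem_univ j), hmj1, pow_one]
      congr 1
      refine Finset.prod_congr rfl fun i hi => ?_
      rcases le_or_gt ((i : ℕ) + 1) k with hik | hik
      · rw [hg i hik]
      · simp [h0 i hi hik]
    rw [aux a ha, aux c hc, aux b fun _ _ => rfl, ← add_mul, hac, mul_assoc]

/-- A symmetric polynomial is a polynomial in the elementary symmetric polynomials in which only
monomials of weight at most its total degree occur. -/
lemma IsSymmetric.exists_eq_sum_esymm {R : Type*} [CommRing R] {n : ℕ}
    {f : MvPolynomial (Fin n) R} (hf : f.IsSymmetric) :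
    ∃ (s : Finset (Fin n →₀ ℕ)) (r : (Fin n →₀ ℕ) → R),
      (∀ m ∈ s, ∑ i : Fin n, ((i : ℕ) + 1) * m i ≤ f.totalDegree) ∧
      f = ∑ m ∈ s, MvPolynomial.C (r m) * ∏ i : Fin n, esymm (Fin n) R (i + 1) ^ m i := by
  obtain ⟨g, hg⟩ := esymmAlgHom_surjective (σ := Fin n) (n := n) R (by simp) ⟨f, hf⟩
  have hg' : f = ∑ m ∈ g.support,
      MvPolynomial.C (g.coeff m) * ∏ i : Fin n, esymm (Fin n) R (i + 1) ^ m i := by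
    have := congrArg Subtype.val hg
    rw [esymmAlgHom_apply, aeval_def, eval₂_eq'] at this
    simpa [algebraMap_eq] using this.symm
  have hhom : ∀ m : Fin n →₀ ℕ, (MvPolynomial.C (g.coeff m) * ∏ i : Fin n,
      esymm (Fin n) R (i + 1) ^ m i).IsHomogeneous (∑ i : Fin n, ((i : ℕ) + 1) * m i) := by
    intro m
    simpa using (isHomogeneous_C (Fin n) (g.coeff m)).mul (IsHomogeneous.prod Finset.univ _
      (fun i : Fin n => ((i : ℕ) + 1) * m i) fun i _ => (isHomogeneous_esymm (Fin n) R _).pow _)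
  refine ⟨g.support.filter fun m => ∑ i : Fin n, ((i : ℕ) + 1) * m i ≤ f.totalDegree, g.coeff,
    fun m hm => (Finset.mem_filter.1 hm).2, ?_⟩
  conv_lhs => rw [← sum_homogeneousComponent f]
  conv_lhs =>
    enter [2, j]
    rw [hg', map_sum]
  rw [Finset.sum_comm, Finset.sum_filter]
  refine Finset.sum_congr rfl fun m _ => ?_
  simp [homogeneousComponent_of_mem (hhom m)]

lemma IsSymmetric.eval_add_eval {n k : ℕ} {f : MvPolynomial (Fin n) ℝ} (hf : f.IsSymmetric)
    (hk : f.totalDegree < 2 * (k + 1)) {u v x : Fin n → ℝ}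
    (huv : ∀ i, eval u (esymm (Fin n) ℝ i) + eval v (esymm (Fin n) ℝ i) =
      2 * eval x (esymm (Fin n) ℝ i))
    (hu : ∀ i ≤ k, eval u (esymm (Fin n) ℝ i) = eval x (esymm (Fin n) ℝ i)) :
    eval u f + eval v f = 2 * eval x f := by
  obtain ⟨s, r, hs, hfs⟩ := hf.exists_eq_sum_esymm
  rw [hfs]
  simp only [map_sum, map_mul, map_prod, map_pow, eval_C]
  rw [← Finset.sum_add_distrib, Finset.mul_sum]
  refine Finset.sum_congr rfl fun m hm => ?_
  rw [← mul_add, prod_pow_add_prod_pow ((hs m hm).trans_lt hk) (fun i => huv _)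
    fun i hi => hu _ hi]
  ring

lemma isCompact_esymm_fiber {n k : ℕ} (hk : 2 ≤ k) (y : Fin n → ℝ) :
    IsCompact {z : Fin n → ℝ |
      ∀ i ≤ k, eval z (esymm (Fin n) ℝ i) = eval y (esymm (Fin n) ℝ i)} := by
  refine Metric.isCompact_of_isClosed_isBounded ?_ ?_
  · simp only [Set.ofPred_forall]
    exact isClosed_iInter fun i => isClosed_iInter fun _ =>
      isClosed_eq (continuous_eval _) continuous_const
  · refine (Metric.isBounded_closedBall (x := (0 : Fin n → ℝ))
      (r := √(∑ i, y i ^ 2))).subset fun z hz => ?_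
    rw [mem_closedBall_zero_iff, pi_norm_le_iff_of_nonneg (Real.sqrt_nonneg _)]
    intro i
    refine Real.abs_le_sqrt ?_
    rw [sum_sq_eq_esymm, ← hz 1 (by omega), ← hz 2 hk, ← sum_sq_eq_esymm]
    exact Finset.single_le_sum (f := fun i => z i ^ 2) (fun _ _ => sq_nonneg _)
      (Finset.mem_univ i)

lemma IsSymmetric.exists_eval_le {n k : ℕ} {f : MvPolynomial (Fin n) ℝ} (hf : f.IsSymmetric)
    (hk : 2 ≤ k) (hfk : f.totalDegree < 2 * (k + 1)) (y : Fin n → ℝ) :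
    ∃ x : Fin n → ℝ, (Set.range x).ncard ≤ k ∧ eval x f ≤ eval y f := by
  have hcomp := isCompact_esymm_fiber hk y
  set K : Set (Fin n → ℝ) :=
    {z | ∀ i ≤ k, eval z (esymm (Fin n) ℝ i) = eval y (esymm (Fin n) ℝ i)}
  have hyK : y ∈ K := fun _ _ => rfl
  obtain ⟨x₀, hx₀, hmin⟩ := hcomp.exists_isMinOn ⟨y, hyK⟩ (continuous_eval f).continuousOn
  rw [isMinOn_iff] at hmin
  have hcont : Continuous fun z : Fin n → ℝ =>
      ∑ i ∈ Finset.range (n + 1), eval z (esymm (Fin n) ℝ i) ^ 2 :=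
    continuous_finsetSum _ fun i _ => (continuous_eval _).pow 2
  have hM : IsCompact (K ∩ {z | eval z f = eval x₀ f}) :=
    hcomp.inter_right (isClosed_eq (continuous_eval f) continuous_const)
  have hx₀M : x₀ ∈ K ∩ {z | eval z f = eval x₀ f} := ⟨hx₀, rfl⟩
  -- Among the minimizers of `f` on `K`, maximize a strictly convex function of the `esymm`.
  obtain ⟨x, ⟨hxK, hxf⟩, hmax⟩ := hM.exists_isMaxOn ⟨x₀, hx₀M⟩ hcont.continuousOn
  rw [isMaxOn_iff] at hmax
  rw [Set.mem_ofPred_eq] at hxf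
  refine ⟨x, ?_, hxf.trans_le (hmin y hyK)⟩
  by_contra! hlt
  obtain ⟨u, v, huv, hu, j, hj⟩ := exists_esymm_perturbation x hlt
  have huK : u ∈ K := fun i hi => (hu i hi).trans (hxK i hi)
  have hvK : v ∈ K := fun i hi => by
    have h1 := huv i
    have h2 := hu i hi
    have h3 := hxK i hi
    linarith
  have hsum := hf.eval_add_eval hfk huv hu
  have hu1 := hmin u huK
  have hv1 := hmin v hvK
  have hum := hmax u ⟨huK, show eval u f = eval x₀ f by linarith⟩
  have hvm := hmax v ⟨hvK, show eval v f = eval x₀ f by linarith⟩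
  have hjn : j ∈ Finset.range (n + 1) := by
    rw [Finset.mem_range]
    by_contra hlt
    exact hj (by simp [esymm_eq_zero (R := ℝ) (show n < j by omega)])
  have hsq : ∀ i, eval u (esymm (Fin n) ℝ i) ^ 2 + eval v (esymm (Fin n) ℝ i) ^ 2 =
      2 * eval x (esymm (Fin n) ℝ i) ^ 2 +
        2 * (eval u (esymm (Fin n) ℝ i) - eval x (esymm (Fin n) ℝ i)) ^ 2 := fun i => by
    rw [eq_sub_of_add_eq' (huv i)]
    ring
  have hstrict : ∑ i ∈ Finset.range (n + 1), 2 * eval x (esymm (Fin n) ℝ i) ^ 2 <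
      ∑ i ∈ Finset.range (n + 1),
        (eval u (esymm (Fin n) ℝ i) ^ 2 + eval v (esymm (Fin n) ℝ i) ^ 2) := by
    refine Finset.sum_lt_sum (fun i _ => ?_) ⟨j, hjn, ?_⟩
    · rw [hsq]
      exact le_add_of_nonneg_right (by positivity)
    · rw [hsq]
      have := pow_pos (abs_pos.2 (sub_ne_zero.2 hj)) 2
      rw [sq_abs] at this
      exact lt_add_of_pos_right _ (by positivity)
  rw [← Finset.mul_sum, Finset.sum_add_distrib] at hstrict
  linarith

end MvPolynomial

/-- **Half-degree principle.**  A symmetric polynomial `f` of degree `d ≥ 1` is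
nonnegative on `ℝ^n` iff it is nonnegative on all points with at most
`k := max 2 ⌊d/2⌋` distinct coordinates. -/
theorem half_degree_principle (n d : ℕ) (hd : 1 ≤ d)
    (f : MvPolynomial (Fin n) ℝ) (hsym : f.IsSymmetric) (hdeg : f.totalDegree = d) :
    (∀ y : Fin n → ℝ, 0 ≤ eval y f) ↔
      (∀ y : Fin n → ℝ, (Set.range y).ncard ≤ max 2 (d / 2) → 0 ≤ eval y f) := by
  refine ⟨fun h y _ => h y, fun h y => ?_⟩
  obtain ⟨x, hx, hxy⟩ := hsym.exists_eval_le (k := max 2 (d / 2)) (le_max_left _ _)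
    (by omega) y
  exact (h x hx).trans hxy
end

section
/- Let f ∈ ℝ[X_1,…,X_n] be a symmetric polynomial of total degree d ≥ 1, and set k := max{2, ⌊d/2⌋}. Then the real zero set V := {y ∈ ℝ^n : f(y) = 0} is nonempty if and only if V ∩ A_k ≠ ∅, i.e., f has a real zero if and only if it has a real zero with at most k distinct coordinates. -/
open MvPolynomial

/-- A symmetric polynomial is a polynomial in the elementary symmetric polynomials whose
weighted degree is at most the total degree of the given polynomial. -/
theorem MvPolynomial.IsSymmetric.exists_aeval_esymm_eq {R : Type*} [CommRing R] {n : ℕ}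
    {f : MvPolynomial (Fin n) R} (hf : f.IsSymmetric) :
    ∃ g : MvPolynomial (Fin n) R,
      aeval (fun i : Fin n ↦ esymm (Fin n) R (i + 1)) g = f ∧
      ∀ a ∈ g.support, ∑ i, a i * (i + 1 : ℕ) ≤ f.totalDegree := by
  obtain ⟨G, hG⟩ := esymmAlgHom_fin_surjective R le_rfl ⟨f, hf⟩
  replace hG : aeval (fun i : Fin n ↦ esymm (Fin n) R (i + 1)) G = f := by
    rw [← esymmAlgHom_apply, hG]
  set φ : MvPolynomial (Fin n) R →ₐ[R] MvPolynomial (Fin n) R :=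
    aeval (fun i : Fin n ↦ esymm (Fin n) R (i + 1)) with hφ
  let w : (Fin n →₀ ℕ) → ℕ := fun a ↦ ∑ i, a i * (i + 1 : ℕ)
  have hom (a : Fin n →₀ ℕ) (c : R) : (φ (monomial a c)).IsHomogeneous (w a) := by
    rw [hφ, aeval_monomial, algebraMap_eq, Finsupp.prod_fintype _ _ (by simp)]
    refine IsHomogeneous.C_mul (IsHomogeneous.prod _ _ _ fun i _ ↦ ?_) c
    rw [mul_comm]
    refine IsHomogeneous.pow ?_ _
    refine IsHomogeneous.sum _ _ _ fun t ht ↦ ?_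
    have := IsHomogeneous.prod t (fun j ↦ (X j : MvPolynomial (Fin n) R)) (fun _ ↦ 1)
      fun j _ ↦ isHomogeneous_X _ _
    simpa [(Finset.mem_powersetCard.1 ht).2] using this
  refine ⟨∑ a ∈ G.support with w a ≤ f.totalDegree, monomial a (G.coeff a), ?_, fun a ha ↦ ?_⟩
  · ext b
    have hGb : f.coeff b = ∑ a ∈ G.support, (φ (monomial a (G.coeff a))).coeff b := by
      rw [← coeff_sum, ← map_sum, support_sum_monomial_coeff, hG]
    rw [map_sum, coeff_sum]
    by_cases hb : b.degree ≤ f.totalDegree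
    · rw [hGb]
      refine Finset.sum_subset (Finset.filter_subset _ _) fun a ha ha' ↦ ?_
      refine (hom a _).coeff_eq_zero fun h ↦ ha' ?_
      exact Finset.mem_filter.2 ⟨ha, h ▸ hb⟩
    · rw [coeff_eq_zero_of_totalDegree_lt (f := f) (not_le.1 hb)]
      refine Finset.sum_eq_zero fun a ha ↦ (hom a _).coeff_eq_zero fun h ↦ hb ?_
      exact h ▸ (Finset.mem_filter.1 ha).2
  · obtain ⟨c, hc, hac⟩ := Finset.mem_biUnion.1 (support_sum ha)
    obtain rfl := Finset.mem_singleton.1 (support_monomial_subset hac)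
    exact (Finset.mem_filter.1 hc).2

/-- A polynomial whose weighted degree is less than `2 (k + 1)`, where the `i`-th variable
(counted from `0`) has weight `i + 1`, is affine in the variables of index at least `k`. -/
theorem MvPolynomial.eval_add_add_eval_sub_of_weight_lt {R : Type*} [CommRing R] {n k : ℕ}
    {g : MvPolynomial (Fin n) R}
    (hg : ∀ a ∈ g.support, ∑ i, a i * (i + 1 : ℕ) < 2 * (k + 1))
    (v δ : Fin n → R) (hδ : ∀ i : Fin n, (i : ℕ) < k → δ i = 0) :
    eval (v + δ) g + eval (v - δ) g = 2 * eval v g := by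
  simp only [eval_eq', Finset.mul_sum, ← Finset.sum_add_distrib]
  refine Finset.sum_congr rfl fun a ha ↦ ?_
  rw [← mul_add, mul_left_comm]
  congr 1
  by_cases h0 : ∃ j : Fin n, k ≤ j ∧ a j ≠ 0
  · obtain ⟨j, hj, haj⟩ := h0
    have hsum := hg a ha
    rw [← Finset.add_sum_erase _ _ (Finset.mem_univ j)] at hsum
    have haj1 : a j = 1 := by
      by_contra hne
      have : 2 * (k + 1) ≤ a j * (j + 1 : ℕ) := Nat.mul_le_mul (by omega) (by omega)
      omega
    have hrest (i : Fin n) (hi : i ∈ Finset.univ.erase j) : a i = 0 ∨ δ i = 0 := by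
      by_contra! h
      have hki : k ≤ i := not_lt.1 fun hlt ↦ h.2 (hδ i hlt)
      have h1 : a i * (i + 1 : ℕ) ≤ ∑ i ∈ Finset.univ.erase j, a i * (i + 1 : ℕ) :=
        Finset.single_le_sum (f := fun i : Fin n ↦ a i * (i + 1 : ℕ)) (by simp) hi
      have h2 : 1 * (k + 1) ≤ a i * (i + 1 : ℕ) :=
        Nat.mul_le_mul (Nat.one_le_iff_ne_zero.2 h.1) (by omega)
      rw [haj1] at hsum
      omega
    simp only [← Finset.mul_prod_erase _ _ (Finset.mem_univ j), haj1, pow_one]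
    have hp : ∏ i ∈ Finset.univ.erase j, (v + δ) i ^ a i =
        ∏ i ∈ Finset.univ.erase j, v i ^ a i :=
      Finset.prod_congr rfl fun i hi ↦ by rcases hrest i hi with h | h <;> simp [h]
    have hm : ∏ i ∈ Finset.univ.erase j, (v - δ) i ^ a i =
        ∏ i ∈ Finset.univ.erase j, v i ^ a i :=
      Finset.prod_congr rfl fun i hi ↦ by rcases hrest i hi with h | h <;> simp [h]
    rw [hp, hm, Pi.add_apply, Pi.sub_apply]
    ring
  · push Not at h0
    have hz (i : Fin n) : a i = 0 ∨ δ i = 0 := by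
      rcases lt_or_ge (i : ℕ) k with h | h
      · exact Or.inr (hδ i h)
      · exact Or.inl (h0 i h)
    have hp : ∏ i, (v + δ) i ^ a i = ∏ i, v i ^ a i :=
      Finset.prod_congr rfl fun i _ ↦ by rcases hz i with h | h <;> simp [h]
    have hm : ∏ i, (v - δ) i ^ a i = ∏ i, v i ^ a i :=
      Finset.prod_congr rfl fun i _ ↦ by rcases hz i with h | h <;> simp [h]
    rw [hp, hm, two_mul]

/-- Small vertical translates of a real polynomial with simple real roots split. -/
theorem Polynomial.eventually_splits_prod_X_sub_C_sub_C (S : Finset ℝ) :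
    ∀ᶠ c in nhds (0 : ℝ),
      (∏ r ∈ S, (Polynomial.X - Polynomial.C r) - Polynomial.C c).Splits := by
  set p : Polynomial ℝ := ∏ r ∈ S, (Polynomial.X - Polynomial.C r) with hp
  obtain ⟨U, hU, hdisj⟩ := S.finite_toSet.t2_separation
  have hopen : ∀ᶠ c in nhds (0 : ℝ), ∀ r ∈ S, ∃ x ∈ U r, p.eval x = c := by
    refine (Filter.eventually_all_finset S).2 fun r hr ↦ ?_
    have hroot : p.eval r = 0 := by
      rw [hp, Polynomial.eval_prod]
      exact Finset.prod_eq_zero hr (by simp)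
    have hsep : p.Separable := Polynomial.separable_prod_X_sub_C_iff'.2 fun _ _ _ _ h ↦ h
    have hder : p.derivative.eval r ≠ 0 := by
      simpa [Polynomial.eval₂_eq_eval_map] using
        hsep.eval₂_derivative_ne_zero (RingHom.id ℝ) (x := r) (by simpa using hroot)
    have hmap := (p.hasStrictDerivAt r).map_nhds_eq hder
    rw [hroot] at hmap
    have := Filter.image_mem_map (m := fun x ↦ p.eval x) ((hU r).2.mem_nhds (hU r).1)
    rw [hmap] at this
    exact this
  filter_upwards [hopen] with c hc
  choose! x hxU hx using hc
  have hdeg : (p - Polynomial.C c).natDegree = S.card := by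
    rw [Polynomial.natDegree_sub_C, hp, Polynomial.natDegree_prod_of_monic _ _
      fun r _ ↦ Polynomial.monic_X_sub_C r]
    simp
  rcases S.eq_empty_or_nonempty with rfl | hS
  · exact Polynomial.Splits.of_natDegree_le_one (by simp [hdeg])
  have hne : p - Polynomial.C c ≠ 0 := by
    intro h
    rw [h, Polynomial.natDegree_zero] at hdeg
    exact hS.card_pos.ne hdeg
  have hinj : Set.InjOn x S := by
    intro r hr s hs hrs
    by_contra hne
    exact Set.disjoint_left.1 (hdisj hr hs hne) (hxU r hr) (hrs ▸ hxU s hs)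
  have hsub : S.image x ⊆ (p - Polynomial.C c).roots.toFinset := by
    intro y hy
    obtain ⟨r, hr, rfl⟩ := Finset.mem_image.1 hy
    simp [hne, hx r hr]
  refine Polynomial.splits_iff_card_roots.2 (le_antisymm (Polynomial.card_roots' _) ?_)
  rw [hdeg, ← Finset.card_image_of_injOn hinj]
  exact (Finset.card_le_card hsub).trans (Multiset.toFinset_card_le _)

theorem Polynomial.Splits.exists_eq_prod_X_sub_C {K : Type*} [Field K] {n : ℕ}
    {p : Polynomial K} (hp : p.Splits) (hm : p.Monic) (hn : p.natDegree = n) :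
    ∃ x : Fin n → K, p = ∏ i, (Polynomial.X - Polynomial.C (x i)) := by
  have hcard : p.roots.toList.length = n := by
    rw [Multiset.length_toList, ← hn, Polynomial.splits_iff_card_roots.1 hp]
  subst hcard
  refine ⟨fun i ↦ p.roots.toList[i], ?_⟩
  have h := Fin.prod_univ_fun_getElem p.roots.toList fun a ↦ Polynomial.X - Polynomial.C a
  rw [← Multiset.prod_coe, ← Multiset.map_coe, Multiset.coe_toList] at h
  exact (hp.eq_prod_roots_of_monic hm).trans h.symm

theorem MvPolynomial.eval_esymm_eq_coeff_s9 {R : Type*} [CommRing R] {n : ℕ} (x : Fin n → R)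
    {j : ℕ} (hj : j ≤ n) :
    eval x (esymm (Fin n) R j) =
      (-1) ^ j * (∏ i, (Polynomial.X - Polynomial.C (x i))).coeff (n - j) := by
  have h := Multiset.prod_X_sub_C_coeff (Finset.univ.val.map x) (k := n - j) (by simp)
  simp only [Multiset.map_map, Multiset.card_map, Finset.card_val, Finset.card_univ,
    Fintype.card_fin, Nat.sub_sub_self hj] at h
  rw [show ∏ i, (Polynomial.X - Polynomial.C (x i)) = _ from rfl, Finset.prod,
    show (fun i ↦ Polynomial.X - Polynomial.C (x i)) =
      (fun t ↦ Polynomial.X - Polynomial.C t) ∘ x from rfl, h, ← mul_assoc, ← mul_pow,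
    ← aeval_esymm_eq_multiset_esymm (σ := Fin n) (R := R), aeval_eq_eval]
  simp

/-- If a real point has more than `k` distinct coordinates, then its vector of elementary
symmetric functions can be moved both ways along a line within the set of such vectors, keeping
its first `k` entries. -/
theorem exists_esymm_add_sub {n k : ℕ} (x : Fin n → ℝ) (hx : k < (Set.range x).ncard) :
    ∃ δ : Fin n → ℝ, δ ≠ 0 ∧ (∀ i : Fin n, (i : ℕ) < k → δ i = 0) ∧
      ∃ u v : Fin n → ℝ,
        (fun i : Fin n ↦ eval u (esymm (Fin n) ℝ (i + 1))) =
          (fun i : Fin n ↦ eval x (esymm (Fin n) ℝ (i + 1))) + δ ∧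
        (fun i : Fin n ↦ eval v (esymm (Fin n) ℝ (i + 1))) =
          (fun i : Fin n ↦ eval x (esymm (Fin n) ℝ (i + 1))) - δ := by
  classical
  let S : Finset ℝ := Finset.univ.image x
  have hS : k < S.card := by
    rwa [← Set.ncard_coe_finset, Finset.coe_image, Finset.coe_univ, Set.image_univ]
  set m : Multiset ℝ := Finset.univ.val.map x with hm
  have hSm : S.val ≤ m := by
    rw [show S.val = m.dedup from rfl]
    exact Multiset.dedup_le m
  set p : Polynomial ℝ := ∏ r ∈ S, (Polynomial.X - Polynomial.C r) with hp
  set q : Polynomial ℝ := ((m - S.val).map fun r ↦ Polynomial.X - Polynomial.C r).prod with hq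
  have hpq : p * q = ∏ i, (Polynomial.X - Polynomial.C (x i)) := by
    rw [hp, hq, Finset.prod, ← Multiset.prod_add, ← Multiset.map_add,
      add_tsub_cancel_of_le hSm, hm, Multiset.map_map]
    rfl
  have hpm : p.Monic := Polynomial.monic_prod_of_monic _ _ fun r _ ↦ Polynomial.monic_X_sub_C r
  have hpd : p.natDegree = S.card := by
    rw [hp, Polynomial.natDegree_prod_of_monic _ _ fun r _ ↦ Polynomial.monic_X_sub_C r]
    simp
  have hqm : q.Monic := Polynomial.monic_multiset_prod_of_monic _ _
    fun r _ ↦ Polynomial.monic_X_sub_C r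
  have hqs : q.Splits := by
    refine Polynomial.Splits.multisetProd fun f hf ↦ ?_
    obtain ⟨r, -, rfl⟩ := Multiset.mem_map.1 hf
    exact Polynomial.Splits.X_sub_C r
  have hnd : S.card + q.natDegree = n := by
    rw [← hpd, ← hpm.natDegree_mul hqm, hpq,
      Polynomial.natDegree_prod_of_monic _ _ fun r _ ↦ Polynomial.monic_X_sub_C _]
    simp
  have hlift (c : ℝ) (hc : (p - Polynomial.C c).Splits) : ∃ u : Fin n → ℝ,
      (p - Polynomial.C c) * q = ∏ i, (Polynomial.X - Polynomial.C (u i)) := by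
    have hcm : (p - Polynomial.C c).Monic := by
      refine hpm.sub_of_left (Polynomial.degree_C_le.trans_lt ?_)
      rw [← Polynomial.natDegree_pos_iff_degree_pos, hpd]
      omega
    refine (hc.mul hqs).exists_eq_prod_X_sub_C (hcm.mul hqm) ?_
    rw [hcm.natDegree_mul hqm, Polynomial.natDegree_sub_C, hpd, hnd]
  have hev := Polynomial.eventually_splits_prod_X_sub_C_sub_C S
  have hneg : ∀ᶠ c in nhds (0 : ℝ), (p - Polynomial.C (-c)).Splits :=
    (continuous_neg.tendsto' (0 : ℝ) 0 neg_zero).eventually hev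
  have hboth := (hev.and hneg).filter_mono (nhdsWithin_le_nhds (s := {0}ᶜ))
  obtain ⟨c, ⟨hc₁, hc₂⟩, hc₀⟩ := (hboth.and self_mem_nhdsWithin).exists
  obtain ⟨v, hv⟩ := hlift c hc₁
  obtain ⟨u, hu⟩ := hlift (-c) hc₂
  refine ⟨fun i ↦ (-1) ^ (i + 1 : ℕ) * (c * q.coeff (n - (i + 1))), fun h ↦ ?_, fun i hi ↦ ?_,
    u, v, ?_, ?_⟩
  · have h1 := congrFun h ⟨S.card - 1, by omega⟩
    have h2 : n - (S.card - 1 + 1) = q.natDegree := by omega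
    simp only [h2, hqm.coeff_natDegree] at h1
    simp at h1
    exact hc₀ h1
  · simp [Polynomial.coeff_eq_zero_of_natDegree_lt (show q.natDegree < n - (i + 1) by omega)]
  · funext i
    have hi : (i : ℕ) + 1 ≤ n := i.2
    rw [Pi.add_apply, eval_esymm_eq_coeff_s9 u hi, eval_esymm_eq_coeff_s9 x hi, ← hu, ← hpq,
      map_neg, sub_neg_eq_add, add_mul, Polynomial.coeff_add, Polynomial.coeff_C_mul]
    ring
  · funext i
    have hi : (i : ℕ) + 1 ≤ n := i.2
    rw [Pi.sub_apply, eval_esymm_eq_coeff_s9 v hi, eval_esymm_eq_coeff_s9 x hi, ← hv, ← hpq,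
      sub_mul, Polynomial.coeff_sub, Polynomial.coeff_C_mul]
    ring

theorem MvPolynomial.psum_two_eq {R : Type*} [CommRing R] {n : ℕ} :
    psum (Fin n) R 2 = esymm (Fin n) R 1 ^ 2 - 2 * esymm (Fin n) R 2 := by
  have h := mul_esymm_eq_sum (Fin n) R 2
  have hs : {a ∈ Finset.HasAntidiagonal.antidiagonal 2 | a.1 < 2} =
      ({(0, 2), (1, 1)} : Finset (ℕ × ℕ)) := by
    decide
  rw [hs, Finset.sum_pair (by decide)] at h
  simp only [esymm_zero, psum_one, esymm_one] at h ⊢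
  push_cast at h
  linear_combination h

theorem isCompact_setOf_eval_esymm_eq {n k : ℕ} (hk : 2 ≤ k) (hkn : k ≤ n) (e : Fin n → ℝ) :
    IsCompact {x : Fin n → ℝ | ∀ i : Fin n, (i : ℕ) < k →
      eval x (esymm (Fin n) ℝ (i + 1)) = e i} := by
  refine Metric.isCompact_of_isClosed_isBounded ?_ ?_
  · simp only [Set.ofPred_forall]
    refine isClosed_iInter fun i ↦ isClosed_iInter fun _ ↦ ?_
    exact isClosed_eq (MvPolynomial.continuous_eval _) continuous_const
  · refine isBounded_iff_forall_norm_le.2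
      ⟨√(e ⟨0, by omega⟩ ^ 2 - 2 * e ⟨1, by omega⟩), fun x hx ↦ ?_⟩
    have h0 := hx ⟨0, by omega⟩ (by simp; omega)
    have h1 := hx ⟨1, by omega⟩ (by simp; omega)
    refine (pi_norm_le_iff_of_nonneg (Real.sqrt_nonneg _)).2 fun i ↦ ?_
    refine Real.le_sqrt_of_sq_le ?_
    have h2 := congrArg (eval x) (psum_two_eq (R := ℝ) (n := n))
    simp only [zero_add, Nat.reduceAdd] at h0 h1
    rw [map_sub, map_mul, map_pow, h0, h1] at h2
    simp only [psum, map_sum, map_pow, eval_X, map_ofNat] at h2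
    rw [← h2, Real.norm_eq_abs, sq_abs]
    exact Finset.single_le_sum (f := fun i ↦ x i ^ 2) (fun _ _ ↦ sq_nonneg _) (Finset.mem_univ i)

/-- The **half degree principle**: every value of a symmetric polynomial is bounded below by a
value at a point with few distinct coordinates. -/
theorem MvPolynomial.IsSymmetric.exists_eval_le_s9 {n k : ℕ} {f : MvPolynomial (Fin n) ℝ}
    (hf : f.IsSymmetric) (hk : 2 ≤ k) (hd : f.totalDegree < 2 * (k + 1)) (y : Fin n → ℝ) :
    ∃ x : Fin n → ℝ, eval x f ≤ eval y f ∧ (Set.range x).ncard ≤ k := by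
  rcases le_total n k with hnk | hkn
  · refine ⟨y, le_rfl, le_trans ?_ hnk⟩
    rw [← Set.image_univ]
    simpa [Set.ncard_univ] using Set.ncard_image_le (f := y) Set.finite_univ
  obtain ⟨g, hg, hgw⟩ := hf.exists_aeval_esymm_eq
  let E : (Fin n → ℝ) → Fin n → ℝ := fun x i ↦ eval x (esymm (Fin n) ℝ (i + 1))
  have hE (x : Fin n → ℝ) : eval x f = eval (E x) g := by
    rw [← hg, ← aeval_eq_eval, ← aeval_eq_eval]
    exact DFunLike.congr_fun (comp_aeval (R := ℝ) _ (aeval x)) g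
  have hEcont (i : Fin n) : Continuous fun x ↦ E x i := MvPolynomial.continuous_eval _
  let N : (Fin n → ℝ) → ℝ := fun x ↦ ∑ i, E x i ^ 2
  have hN : Continuous N := continuous_finsetSum _ fun i _ ↦ (hEcont i).pow 2
  have hfc : Continuous fun x ↦ eval x f := MvPolynomial.continuous_eval f
  have hK := isCompact_setOf_eval_esymm_eq hk hkn (E y)
  set K := {x : Fin n → ℝ | ∀ i : Fin n, (i : ℕ) < k →
      eval x (esymm (Fin n) ℝ (i + 1)) = E y i}
  have hyK : y ∈ K := fun _ _ ↦ rfl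
  obtain ⟨z, hzK, hz⟩ := hK.exists_isMinOn ⟨y, hyK⟩ hfc.continuousOn
  have hM : IsCompact (K ∩ {x | eval x f = eval z f}) :=
    hK.inter_right (isClosed_eq hfc continuous_const)
  obtain ⟨x, ⟨hxK, hxz⟩, hx⟩ := hM.exists_isMaxOn ⟨z, hzK, rfl⟩ hN.continuousOn
  have hxz : eval x f = eval z f := hxz
  refine ⟨x, hxz.trans_le (hz hyK), ?_⟩
  by_contra! hcard
  obtain ⟨δ, hδ, hδk, u, v, hu, hv⟩ := exists_esymm_add_sub x hcard
  change E u = E x + δ at hu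
  change E v = E x - δ at hv
  have huK : u ∈ K := fun i hi ↦ by
    rw [← hxK i hi]
    simpa [hδk i hi] using congrFun hu i
  have hvK : v ∈ K := fun i hi ↦ by
    rw [← hxK i hi]
    simpa [hδk i hi] using congrFun hv i
  have haff := eval_add_add_eval_sub_of_weight_lt (k := k)
    (fun a ha ↦ (hgw a ha).trans_lt hd) (E x) δ hδk
  rw [← hu, ← hv, ← hE, ← hE, ← hE, hxz] at haff
  have hzu : eval z f ≤ eval u f := hz huK
  have hzv : eval z f ≤ eval v f := hz hvK
  have hNu : N u ≤ N x := hx ⟨huK, show eval u f = eval z f by linarith⟩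
  have hNv : N v ≤ N x := hx ⟨hvK, show eval v f = eval z f by linarith⟩
  have hNsum : N u + N v = 2 * N x + 2 * ∑ i, δ i ^ 2 := by
    simp only [N, hu, hv, Finset.mul_sum, ← Finset.sum_add_distrib, Pi.add_apply, Pi.sub_apply]
    exact Finset.sum_congr rfl fun i _ ↦ by ring
  obtain ⟨i, hi⟩ := Function.ne_iff.1 hδ
  have hpos : 0 < ∑ i, δ i ^ 2 :=
    Finset.sum_pos' (fun _ _ ↦ sq_nonneg _) ⟨i, Finset.mem_univ i, sq_pos_of_ne_zero hi⟩
  linarith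

/-- The set of points with at most `k` distinct coordinates is star-shaped about the origin, so
a polynomial that changes sign on it vanishes somewhere on it. -/
theorem MvPolynomial.exists_eval_eq_zero_of_le_of_ge {n k : ℕ} (f : MvPolynomial (Fin n) ℝ)
    {u v : Fin n → ℝ} (hu : (Set.range u).ncard ≤ k) (hv : (Set.range v).ncard ≤ k)
    (hfu : eval u f ≤ 0) (hfv : 0 ≤ eval v f) :
    ∃ x : Fin n → ℝ, eval x f = 0 ∧ (Set.range x).ncard ≤ k := by
  let A : Set (Fin n → ℝ) := {x | (Set.range x).ncard ≤ k}
  have hsmul (x : Fin n → ℝ) (hx : x ∈ A) (t : ℝ) : t • x ∈ A := by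
    have : Set.range (t • x) = (fun s ↦ t * s) '' Set.range x := by
      rw [← Set.range_comp]
      rfl
    change (Set.range (t • x)).ncard ≤ k
    rw [this]
    exact (Set.ncard_image_le (Set.finite_range x)).trans hx
  have hconn : IsPreconnected A := by
    have hstar : StarConvex ℝ 0 A := by
      refine starConvex_zero_iff.2 fun x hx t _ _ ↦ hsmul x hx t
    exact (hstar.isPathConnected (by simpa using hsmul u hu 0)).isConnected.isPreconnected
  obtain ⟨x, hxA, hx⟩ := hconn.intermediate_value (a := u) (b := v) hu hv
    (MvPolynomial.continuous_eval f).continuousOn ⟨hfu, hfv⟩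
  exact ⟨x, hx, hxA⟩

/-- A symmetric polynomial `f` of degree `d ≥ 1` has a real zero iff it has a real
zero with at most `k := max 2 ⌊d/2⌋` distinct coordinates. -/
theorem half_degree_principle_zero_set (n d : ℕ) (hd : 1 ≤ d)
    (f : MvPolynomial (Fin n) ℝ) (hsym : f.IsSymmetric) (hdeg : f.totalDegree = d) :
    (∃ y : Fin n → ℝ, eval y f = 0) ↔
      (∃ y : Fin n → ℝ, eval y f = 0 ∧ (Set.range y).ncard ≤ max 2 (d / 2)) := by
  refine ⟨fun ⟨y, hy⟩ ↦ ?_, fun ⟨y, hy, _⟩ ↦ ⟨y, hy⟩⟩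
  have hk : d < 2 * (max 2 (d / 2) + 1) := by omega
  obtain ⟨u, hfu, hu⟩ := hsym.exists_eval_le_s9 (le_max_left 2 (d / 2)) (hdeg ▸ hk) y
  obtain ⟨v, hfv, hv⟩ := hsym.neg.exists_eval_le_s9 (le_max_left 2 (d / 2))
    (by rwa [totalDegree_neg, hdeg]) y
  rw [hy] at hfu
  rw [map_neg, map_neg, hy, neg_zero, neg_nonpos] at hfv
  exact exists_eval_eq_zero_of_le_of_ge f hu hv hfu hfv
end

section
/- Half-degree principle, partition form: Let f ∈ ℝ[X_1,…,X_n] be a symmetric polynomial of total degree d ≥ 1, and set k := max{2, ⌊d/2⌋}. Suppose that for every k-partition ϑ = (ϑ_1,…,ϑ_k) of n, the k-variate polynomial f^ϑ(T_1,…,T_k) := f(T_1,…,T_1, T_2,…,T_2, …, T_k,…,T_k) (where T_i is repeated ϑ_i times) is nonnegative on all of ℝ^k. Then f(y) ≥ 0 for all y ∈ ℝ^n. -/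
open MvPolynomial

/-- Given block sizes `ϑ : Fin k → ℕ` and values `t : Fin k → ℝ`, the point of `ℝ^n`
whose first `ϑ 0` coordinates equal `t 0`, next `ϑ 1` coordinates equal `t 1`, etc.
(When `∑ b, ϑ b = n`, each index lies in exactly one block.) -/
noncomputable def blockPoint (n k : ℕ) (ϑ : Fin k → ℕ) (t : Fin k → ℝ) :
    Fin n → ℝ := fun i =>
  ∑ b : Fin k,
    if (∑ c ∈ Finset.Iio b, ϑ c) ≤ (i : ℕ) ∧ (i : ℕ) < ∑ c ∈ Finset.Iic b, ϑ c
    then t b else 0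

/-- A symmetric polynomial is a polynomial in the elementary symmetric polynomials whose weighted
degree is at most the total degree. -/
theorem exists_aeval_esymm_eq_of_isSymmetric {n : ℕ} {f : MvPolynomial (Fin n) ℝ}
    (hf : f.IsSymmetric) :
    ∃ g : MvPolynomial (Fin n) ℝ, (∀ s ∈ g.support, ∑ i, s i * (i + 1 : ℕ) ≤ f.totalDegree) ∧
      f = aeval (fun i : Fin n ↦ esymm (Fin n) ℝ (i + 1)) g := by
  classical
  obtain ⟨g, hg⟩ := esymmAlgHom_fin_surjective ℝ (le_refl n) ⟨f, hf⟩
  replace hg := congrArg Subtype.val hg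
  rw [esymmAlgHom_apply] at hg
  simp only at hg
  let w : (Fin n →₀ ℕ) → ℕ := fun s ↦ ∑ i, s i * (i + 1 : ℕ)
  let m : (Fin n →₀ ℕ) → MvPolynomial (Fin n) ℝ := fun s ↦
    aeval (fun i : Fin n ↦ esymm (Fin n) ℝ (i + 1)) (monomial s (coeff s g))
  have hesymm (j : ℕ) : (esymm (Fin n) ℝ j).IsHomogeneous j := by
    refine IsHomogeneous.sum _ _ _ fun t ht ↦ ?_
    rw [Finset.mem_powersetCard] at ht
    simpa [ht.2] using IsHomogeneous.prod t (fun i ↦ (X i : MvPolynomial (Fin n) ℝ)) (fun _ ↦ 1)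
      fun i _ ↦ isHomogeneous_X ℝ i
  have hm (s) : (m s).IsHomogeneous (w s) := by
    simp only [m, aeval_monomial, algebraMap_eq]
    refine IsHomogeneous.C_mul ?_ _
    rw [Finsupp.prod_fintype _ _ (by simp)]
    refine IsHomogeneous.prod _ _ _ fun i _ ↦ ?_
    rw [mul_comm]
    exact (hesymm _).pow _
  have hfm : f = ∑ s ∈ g.support, m s := by
    rw [← hg]
    conv_lhs => rw [g.as_sum]
    rw [map_sum]
  refine ⟨∑ s ∈ g.support with w s ≤ f.totalDegree, monomial s (coeff s g), ?_, ?_⟩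
  · intro s hs
    have := support_sum hs
    simp only [Finset.mem_biUnion, Finset.mem_filter] at this
    obtain ⟨t, ht, hst⟩ := this
    have := support_monomial_subset hst
    rw [Finset.mem_singleton] at this
    exact this ▸ ht.2
  · have h1 : f = ∑ j ∈ Finset.range (f.totalDegree + 1), homogeneousComponent j f :=
      (sum_homogeneousComponent f).symm
    have h2 (j) : homogeneousComponent j f = ∑ s ∈ g.support, if w s = j then m s else 0 := by
      conv_lhs => rw [hfm]
      rw [map_sum]
      refine Finset.sum_congr rfl fun s _ ↦ ?_
      rw [homogeneousComponent_of_mem (hm s)]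
      simp [eq_comm]
    rw [map_sum]
    conv_lhs => rw [h1]
    simp only [h2]
    rw [Finset.sum_comm, Finset.sum_filter]
    refine Finset.sum_congr rfl fun s _ ↦ ?_
    simp [Finset.sum_ite_eq, m]

/-- A symmetric polynomial of degree less than `2 * (k + 1)` is affine in the elementary symmetric
polynomials of degree greater than `k`. -/
theorem eval_add_eval_eq_of_isSymmetric {n k : ℕ} {f : MvPolynomial (Fin n) ℝ}
    (hf : f.IsSymmetric) (hdeg : f.totalDegree < 2 * (k + 1)) {x y z : Fin n → ℝ} {r : ℕ → ℝ}
    (hr : ∀ j ≤ k, r j = 0)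
    (hy : ∀ j, eval y (esymm (Fin n) ℝ j) = eval x (esymm (Fin n) ℝ j) + r j)
    (hz : ∀ j, eval z (esymm (Fin n) ℝ j) = eval x (esymm (Fin n) ℝ j) - r j) :
    eval y f + eval z f = 2 * eval x f := by
  classical
  obtain ⟨g, hg, rfl⟩ := exists_aeval_esymm_eq_of_isSymmetric hf
  have key (v : Fin n → ℝ) : eval v (aeval (fun i : Fin n ↦ esymm (Fin n) ℝ (i + 1)) g) =
      ∑ s ∈ g.support, coeff s g * ∏ i : Fin n, eval v (esymm (Fin n) ℝ (i + 1)) ^ s i := by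
    conv_lhs => rw [g.as_sum]
    simp only [map_sum, aeval_monomial, algebraMap_eq, map_mul, eval_C]
    simp [Finsupp.prod_fintype]
  rw [key, key, key, ← Finset.sum_add_distrib, Finset.mul_sum]
  refine Finset.sum_congr rfl fun s hs ↦ ?_
  rw [← mul_add, mul_left_comm]
  congr 1
  have hs' := (hg s hs).trans_lt hdeg
  simp only [hy, hz]
  by_cases h : ∃ i : Fin n, k < i + 1 ∧ s i ≠ 0
  · obtain ⟨i, hi, hsi⟩ := h
    rw [← Finset.add_sum_erase _ _ (Finset.mem_univ i)] at hs'
    have hsi1 : s i = 1 := by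
      by_contra hne
      have h2 : 2 ≤ s i := by omega
      have := Nat.mul_le_mul h2 (Nat.succ_le_of_lt hi)
      omega
    have hother : ∀ j ∈ Finset.univ.erase i, r (j + 1) = 0 ∨ s j = 0 := by
      intro j hj
      by_contra! hcon
      have hjk : k < j + 1 := by
        by_contra hle
        exact hcon.1 (hr _ (by omega))
      have h1 := Finset.single_le_sum (f := fun j : Fin n ↦ s j * (j + 1 : ℕ))
        (fun _ _ ↦ Nat.zero_le _) hj
      have h2 : 1 ≤ s j := by have := hcon.2; omega
      have := Nat.mul_le_mul h2 (Nat.succ_le_of_lt hjk)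
      rw [hsi1] at hs'
      omega
    simp only [← Finset.mul_prod_erase _ _ (Finset.mem_univ i), hsi1, pow_one]
    have e1 : ∏ j ∈ Finset.univ.erase i, (eval x (esymm (Fin n) ℝ (j + 1)) + r (j + 1)) ^ s j =
        ∏ j ∈ Finset.univ.erase i, eval x (esymm (Fin n) ℝ (j + 1)) ^ s j :=
      Finset.prod_congr rfl fun j hj ↦ by rcases hother j hj with h | h <;> simp [h]
    have e2 : ∏ j ∈ Finset.univ.erase i, (eval x (esymm (Fin n) ℝ (j + 1)) - r (j + 1)) ^ s j =
        ∏ j ∈ Finset.univ.erase i, eval x (esymm (Fin n) ℝ (j + 1)) ^ s j :=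
      Finset.prod_congr rfl fun j hj ↦ by rcases hother j hj with h | h <;> simp [h]
    rw [e1, e2]
    ring
  · push Not at h
    rw [two_mul]
    congr 1 <;> refine Finset.prod_congr rfl fun j _ ↦ ?_ <;>
    · rcases le_or_gt ((j : ℕ) + 1) k with hj | hj
      · simp [hr _ hj]
      · simp [h j hj]

open Polynomial Filter Topology in
/-- Adding to `∏ i, (X - C (x i))` a small multiple of the product of the factors outside `T`
keeps all roots real, provided the roots with index in `T` are distinct. -/
theorem eventually_exists_prod_X_sub_C_eq_add {σ : Type*} [Fintype σ] [DecidableEq σ]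
    {x : σ → ℝ} {T : Finset σ} (hT : T.Nonempty) (hx : Set.InjOn x T) :
    ∀ᶠ c in 𝓝 (0 : ℝ), ∃ y : σ → ℝ,
      ∏ i, (Polynomial.X - Polynomial.C (y i)) =
        ∏ i, (Polynomial.X - Polynomial.C (x i)) +
          Polynomial.C c * ∏ i ∈ Tᶜ, (Polynomial.X - Polynomial.C (x i)) := by
  set Q : ℝ[X] := ∏ i ∈ T, (Polynomial.X - Polynomial.C (x i)) with hQ
  obtain ⟨U, hU, hUd⟩ := (T.image x).finite_toSet.t2_separation
  have hroot (i) (hi : i ∈ T) : Q.eval (x i) = 0 := by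
    rw [hQ, Polynomial.eval_prod]
    exact Finset.prod_eq_zero hi (by simp)
  have hderiv (i) (hi : i ∈ T) : Q.derivative.eval (x i) ≠ 0 := by
    have : Q.Separable := separable_prod_X_sub_C_iff'.2 fun i hi j hj h ↦ hx hi hj h
    exact this.eval₂_derivative_ne_zero (RingHom.id ℝ)
      (by simpa [Polynomial.eval₂_id] using hroot i hi)
  have hnear : ∀ᶠ c in 𝓝 (0 : ℝ), ∀ i ∈ T, ∃ u ∈ U (x i), Q.eval u = c := by
    rw [Filter.eventually_all_finset]
    intro i hi
    have h := (Q.hasStrictDerivAt (x i)).map_nhds_eq (hderiv i hi)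
    rw [hroot i hi] at h
    rw [← h]
    exact image_mem_map ((hU (x i)).2.mem_nhds (hU (x i)).1)
  have hneg : Tendsto (fun c : ℝ ↦ -c) (𝓝 0) (𝓝 0) := by
    simpa using (continuous_neg (G := ℝ)).tendsto 0
  filter_upwards [hneg.eventually hnear] with c hc
  choose! u huU hu using hc
  have hinj : Set.InjOn u T := by
    intro i hi j hj hij
    by_contra hne
    have hd := hUd (Finset.mem_coe.2 (Finset.mem_image_of_mem x hi))
      (Finset.mem_coe.2 (Finset.mem_image_of_mem x hj)) fun h ↦ hne (hx hi hj h)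
    exact Set.disjoint_left.1 hd (huU i hi) (hij ▸ huU j hj)
  have hmonic : Q.Monic := monic_prod_X_sub_C _ _
  have hdegQ : Q.degree = T.card := by
    rw [hQ, degree_prod]; simp
  have hdegC : (Polynomial.C c : ℝ[X]).degree < Q.degree := by
    rw [hdegQ]
    exact degree_C_le.trans_lt (by exact_mod_cast hT.card_pos)
  have hprod : ∏ i ∈ T, (Polynomial.X - Polynomial.C (u i)) = Q + Polynomial.C c := by
    refine eq_of_degree_sub_lt_of_eval_index_eq T hinj ?_ ?_
    · rw [← hdegQ]
      have hdeg : (∏ i ∈ T, (Polynomial.X - Polynomial.C (u i))).degree = Q.degree := by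
        rw [hdegQ, degree_prod]; simp
      rw [← hdeg]
      refine degree_sub_lt_left ?_ (monic_prod_X_sub_C _ _).ne_zero ?_
      · rw [degree_add_eq_left_of_degree_lt hdegC, hdeg]
      · rw [(monic_prod_X_sub_C _ _).leadingCoeff, (hmonic.add_of_left hdegC).leadingCoeff]
    · intro i hi
      rw [Polynomial.eval_prod, Finset.prod_eq_zero hi (by simp)]
      simp [hu i hi]
  refine ⟨fun i ↦ if i ∈ T then u i else x i, ?_⟩
  rw [← Finset.prod_mul_prod_compl T,
    ← Finset.prod_mul_prod_compl T fun i ↦ Polynomial.X - Polynomial.C (x i),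
    ← add_mul, ← hprod]
  congr 1
  · exact Finset.prod_congr rfl fun i hi ↦ by simp [hi]
  · exact Finset.prod_congr rfl fun i hi ↦ by simp [Finset.mem_compl.1 hi]

/-- Vieta formula for the values of the elementary symmetric polynomials. -/
theorem eval_esymm_eq_coeff_prod {n j : ℕ} (hj : j ≤ n) (x : Fin n → ℝ) :
    MvPolynomial.eval x (MvPolynomial.esymm (Fin n) ℝ j) =
      (-1) ^ j * (∏ i, (Polynomial.X - Polynomial.C (x i))).coeff (n - j) := by
  have h := Multiset.prod_X_sub_C_coeff (Finset.univ.val.map x) (k := n - j) (by simp)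
  rw [Multiset.map_map] at h
  have h' : (∏ i, (Polynomial.X - Polynomial.C (x i))).coeff (n - j) =
      (-1) ^ j * (Finset.univ.val.map x).esymm j := by
    simpa only [Multiset.card_map, Finset.card_val, Finset.card_univ, Fintype.card_fin,
      Nat.sub_sub_self hj] using! h
  rw [h', ← mul_assoc, ← mul_pow, ← MvPolynomial.aeval_esymm_eq_multiset_esymm (Fin n) ℝ,
    MvPolynomial.aeval_eq_eval]
  simp

open Polynomial Filter Topology in
/-- If `k + 1` coordinates of `x` are distinct, the values at `x` of the elementary symmetric
polynomials of degree greater than `k` can be moved in opposite directions without changing those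
of degree at most `k`. -/
theorem exists_esymm_perturbation {n k : ℕ} {x : Fin n → ℝ} {T : Finset (Fin n)}
    (hT : T.card = k + 1) (hx : Set.InjOn x T) :
    ∃ r : ℕ → ℝ, (∀ j ≤ k, r j = 0) ∧ 0 < r (k + 1) ∧ ∃ y z : Fin n → ℝ,
      (∀ j, MvPolynomial.eval y (MvPolynomial.esymm (Fin n) ℝ j) =
        MvPolynomial.eval x (MvPolynomial.esymm (Fin n) ℝ j) + r j) ∧
      ∀ j, MvPolynomial.eval z (MvPolynomial.esymm (Fin n) ℝ j) =
        MvPolynomial.eval x (MvPolynomial.esymm (Fin n) ℝ j) - r j := by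
  have hev := eventually_exists_prod_X_sub_C_eq_add (Finset.card_pos.1 (by omega)) hx
  have hneg : Tendsto (fun c : ℝ ↦ -c) (𝓝 0) (𝓝 0) := by
    simpa using (continuous_neg (G := ℝ)).tendsto 0
  obtain ⟨ε, hε, hball⟩ := Metric.eventually_nhds_iff.1 (hev.and (hneg.eventually hev))
  have hkn : k + 1 ≤ n := hT ▸ (Finset.card_le_univ T).trans_eq (Fintype.card_fin n)
  set R : ℝ[X] := ∏ i ∈ Tᶜ, (Polynomial.X - Polynomial.C (x i)) with hR
  have hRmonic : R.Monic := monic_prod_X_sub_C _ _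
  have hRdeg : R.natDegree = n - (k + 1) := by
    rw [hR, natDegree_finsetProd_X_sub_C_eq_card, Finset.card_compl, hT, Fintype.card_fin]
  set c : ℝ := (-1) ^ (k + 1) * (ε / 2) with hc
  obtain ⟨⟨y, hy⟩, z, hz⟩ := hball (y := c) (by
    rw [dist_zero_right, hc, norm_mul, norm_pow]
    simp [abs_of_pos hε, hε])
  refine ⟨fun j ↦ if j ≤ n then (-1) ^ j * (c * R.coeff (n - j)) else 0, ?_, ?_, y, z, ?_, ?_⟩
  · intro j hj
    have : R.coeff (n - j) = 0 := coeff_eq_zero_of_natDegree_lt (by omega)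
    simp [this]
  · have : R.coeff (n - (k + 1)) = 1 := hRdeg ▸ hRmonic.coeff_natDegree
    simp only [hkn, if_true, this, mul_one, hc]
    rw [← mul_assoc, ← mul_pow]
    simpa using hε
  all_goals
    intro j
    by_cases hj : j ≤ n
    · simp only [eval_esymm_eq_coeff_prod hj, hy, hz, hj, if_true, Polynomial.coeff_add,
        map_neg, neg_mul, Polynomial.coeff_neg, Polynomial.coeff_C_mul]
      ring
    · have h0 : MvPolynomial.esymm (Fin n) ℝ j = 0 := by
        rw [MvPolynomial.esymm, Finset.powersetCard_eq_empty.2 (by simpa using hj),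
          Finset.sum_empty]
      simp [h0, hj]

/-- Fixing the first `k ≥ 2` elementary symmetric polynomials cuts out a compact set. -/
theorem isCompact_setOf_esymm_eq {n k : ℕ} (hk : 2 ≤ k) (a : Fin n → ℝ) :
    IsCompact {x : Fin n → ℝ | ∀ j ≤ k,
      eval x (esymm (Fin n) ℝ j) = eval a (esymm (Fin n) ℝ j)} := by
  refine Metric.isCompact_of_isClosed_isBounded ?_ ?_
  · simp only [Set.ofPred_forall]
    exact isClosed_iInter fun j ↦ isClosed_iInter fun _ ↦
      isClosed_eq (MvPolynomial.continuous_eval _) continuous_const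
  · have hsq (x : Fin n → ℝ) : ∑ i, x i ^ 2 =
        eval x (esymm (Fin n) ℝ 1) ^ 2 - 2 * eval x (esymm (Fin n) ℝ 2) := by
      have h := congrArg (eval x) (mul_esymm_eq_sum (Fin n) ℝ 2)
      have hanti : (Finset.HasAntidiagonal.antidiagonal 2).filter (fun a : ℕ × ℕ ↦ a.1 < 2) =
          {(0, 2), (1, 1)} := by decide
      rw [hanti] at h
      simp [psum, esymm_one] at h
      simp [esymm_one]
      linarith
    refine (Metric.isBounded_closedBall (x := (0 : Fin n → ℝ))
      (r := √(∑ i, a i ^ 2))).subset fun x hx ↦ ?_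
    rw [mem_closedBall_zero_iff, pi_norm_le_iff_of_nonneg (Real.sqrt_nonneg _)]
    intro i
    refine Real.abs_le_sqrt ?_
    have : ∑ i, x i ^ 2 = ∑ i, a i ^ 2 := by
      rw [hsq, hsq, hx 1 (by omega), hx 2 hk]
    rw [← this]
    exact Finset.single_le_sum (f := fun i ↦ x i ^ 2) (fun _ _ ↦ sq_nonneg _) (Finset.mem_univ i)

/-- For monotone `g`, the block point whose block sizes are the fibre sizes of `g` is `t ∘ g`. -/
theorem blockPoint_eq_comp_of_monotone {n k : ℕ} {g : Fin n → Fin k} (hg : Monotone g)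
    (t : Fin k → ℝ) :
    blockPoint n k (fun b ↦ (Finset.univ.filter fun i ↦ g i = b).card) t = t ∘ g := by
  have hcard (s : Finset (Fin k)) : ∑ c ∈ s, (Finset.univ.filter fun i ↦ g i = c).card =
      (Finset.univ.filter fun i ↦ g i ∈ s).card := by
    rw [Finset.card_eq_sum_card_fiberwise (f := g) (t := s) (by intro i; simp)]
    refine Finset.sum_congr rfl fun c hc ↦ congrArg _ ?_
    ext i
    simp only [Finset.mem_filter, Finset.mem_univ, true_and]
    exact ⟨fun h ↦ ⟨h ▸ hc, h⟩, fun h ↦ h.2⟩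
  have hblock (i : Fin n) (b : Fin k) :
      ((Finset.univ.filter fun j ↦ g j < b).card ≤ (i : ℕ) ∧
        (i : ℕ) < (Finset.univ.filter fun j ↦ g j ≤ b).card) ↔ b = g i := by
    constructor
    · rintro ⟨h1, h2⟩
      by_contra hne
      rcases lt_or_gt_of_ne hne with h | h
      · have : (Finset.univ.filter fun j ↦ g j ≤ b) ⊆ Finset.Iio i := fun j hj ↦ by
          rw [Finset.mem_filter] at hj
          rw [Finset.mem_Iio]
          by_contra hij
          exact absurd (hg (not_lt.1 hij)) (not_le.2 (hj.2.trans_lt h))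
        have := Finset.card_le_card this
        rw [Fin.card_Iio] at this
        omega
      · have : Finset.Iic i ⊆ (Finset.univ.filter fun j ↦ g j < b) := fun j hj ↦ by
          simpa using (hg (Finset.mem_Iic.1 hj)).trans_lt h
        have := Finset.card_le_card this
        rw [Fin.card_Iic] at this
        omega
    · rintro rfl
      constructor
      · have : (Finset.univ.filter fun j ↦ g j < g i) ⊆ Finset.Iio i := fun j hj ↦ by
          rw [Finset.mem_filter] at hj
          exact Finset.mem_Iio.2 (hg.reflect_lt hj.2)
        simpa using Finset.card_le_card this
      · have : Finset.Iic i ⊆ (Finset.univ.filter fun j ↦ g j ≤ g i) := fun j hj ↦ by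
          simpa using hg (Finset.mem_Iic.1 hj)
        have := Finset.card_le_card this
        rw [Fin.card_Iic] at this
        omega
  funext i
  simp only [blockPoint, hcard, Finset.mem_Iio, Finset.mem_Iic, hblock]
  simp

/-- A point with at most `k` distinct coordinates is, up to permutation, a block point of a
`k`-partition. -/
theorem exists_blockPoint_eq_comp_perm {n k : ℕ} {x : Fin n → ℝ}
    (hx : (Finset.univ.image x).card ≤ k) :
    ∃ ϑ : Fin k → ℕ, Antitone ϑ ∧ ∑ b, ϑ b = n ∧
      ∃ (t : Fin k → ℝ) (σ : Equiv.Perm (Fin n)), blockPoint n k ϑ t = x ∘ σ := by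
  obtain ⟨b, t, hbt⟩ : ∃ (b : Fin n → Fin k) (t : Fin k → ℝ), x = t ∘ b := by
    obtain ⟨e⟩ : Nonempty (Finset.univ.image x ↪ Fin k) :=
      Function.Embedding.nonempty_of_card_le (by simpa using hx)
    refine ⟨fun i ↦ e ⟨x i, Finset.mem_image_of_mem x (Finset.mem_univ i)⟩,
      Function.extend e Subtype.val 0, ?_⟩
    funext i
    simp [e.injective.extend_apply]
  let size : Fin k → ℕ := fun c ↦ (Finset.univ.filter fun i ↦ b i = c).card
  let τ : Equiv.Perm (Fin k) := Tuple.sort (OrderDual.toDual ∘ size)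
  have hτ : Antitone (size ∘ τ) := Tuple.monotone_sort (OrderDual.toDual ∘ size)
  let σ : Equiv.Perm (Fin n) := Tuple.sort (τ.symm ∘ b)
  have hsize (c : Fin k) :
      (Finset.univ.filter fun i ↦ ((τ.symm ∘ b) ∘ σ) i = c).card = size (τ c) := by
    refine Finset.card_bijective σ σ.bijective fun i ↦ ?_
    simp [Equiv.symm_apply_eq]
  refine ⟨size ∘ τ, hτ, ?_, t ∘ τ, σ, ?_⟩
  · rw [Function.comp_def, Equiv.sum_comp τ size]
    simpa using (Finset.card_eq_sum_card_fiberwise (f := b) (s := Finset.univ)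
      (t := Finset.univ) (by simp)).symm
  · have h := blockPoint_eq_comp_of_monotone (Tuple.monotone_sort (τ.symm ∘ b)) (t ∘ τ)
    rw [funext hsize] at h
    refine h.trans ?_
    funext i
    simp [hbt, σ]

/-- A symmetric polynomial of degree less than `2 * (k + 1)` takes, at a point with at most `k`
distinct coordinates, a value that is at most its value at any given point. -/
theorem exists_card_image_le_eval_le {n k : ℕ} (hk : 2 ≤ k) {f : MvPolynomial (Fin n) ℝ}
    (hf : f.IsSymmetric) (hdeg : f.totalDegree < 2 * (k + 1)) (a : Fin n → ℝ) :
    ∃ x : Fin n → ℝ, (Finset.univ.image x).card ≤ k ∧ eval x f ≤ eval a f := by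
  let K : Set (Fin n → ℝ) := {x | ∀ j ≤ k,
    eval x (esymm (Fin n) ℝ j) = eval a (esymm (Fin n) ℝ j)}
  have hKc : IsCompact K := isCompact_setOf_esymm_eq hk a
  have haK : a ∈ K := fun _ _ ↦ rfl
  obtain ⟨m, hmK, hm⟩ := hKc.exists_isMinOn ⟨a, haK⟩ (MvPolynomial.continuous_eval f).continuousOn
  have hMc : IsCompact (K ∩ {x | eval x f = eval m f}) :=
    hKc.inter_right (isClosed_eq (MvPolynomial.continuous_eval f) continuous_const)
  obtain ⟨x, ⟨hxK, hxm⟩, hx⟩ := hMc.exists_isMaxOn ⟨m, hmK, rfl⟩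
    (MvPolynomial.continuous_eval (esymm (Fin n) ℝ (k + 1))).continuousOn
  refine ⟨x, ?_, hxm.trans_le (hm haK)⟩
  by_contra! hcard
  obtain ⟨S, hS, hScard⟩ := Finset.exists_subset_card_eq hcard
  obtain ⟨T, -, hTx, hTS⟩ := Finset.exists_subset_injOn_image_eq_of_surjOn (f := x)
    Set.univ S (fun s hs ↦ by simpa using hS hs)
  have hT : T.card = k + 1 := by
    rw [← Finset.card_image_of_injOn hTx, hTS, hScard]
  obtain ⟨r, hr0, hr, y, z, hy, hz⟩ := exists_esymm_perturbation hT hTx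
  have hyK : y ∈ K := fun j hj ↦ by rw [hy, hr0 j hj, add_zero, hxK j hj]
  have hzK : z ∈ K := fun j hj ↦ by rw [hz, hr0 j hj, sub_zero, hxK j hj]
  have hsum := eval_add_eval_eq_of_isSymmetric hf hdeg hr0 hy hz
  have hym : eval m f ≤ eval y f := hm hyK
  have hzm : eval m f ≤ eval z f := hm hzK
  have hxm' : eval x f = eval m f := hxm
  have hmax : eval y (esymm (Fin n) ℝ (k + 1)) ≤ eval x (esymm (Fin n) ℝ (k + 1)) :=
    hx ⟨hyK, show eval y f = eval m f by linarith⟩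
  linarith [hy (k + 1)]

/-- **Half-degree principle, partition form.**  Let `f` be symmetric of degree `d ≥ 1`
and `k := max 2 ⌊d/2⌋`.  If for every `k`-partition `ϑ ⊢_k n` the `k`-variate
polynomial `f^ϑ` is nonnegative on `ℝ^k`, then `f` is nonnegative on `ℝ^n`. -/
theorem half_degree_principle_partitions (n d : ℕ) (hd : 1 ≤ d)
    (f : MvPolynomial (Fin n) ℝ) (hsym : f.IsSymmetric) (hdeg : f.totalDegree = d)
    (hpart : ∀ ϑ : Fin (max 2 (d / 2)) → ℕ, Antitone ϑ → (∑ b, ϑ b) = n →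
      ∀ t : Fin (max 2 (d / 2)) → ℝ, 0 ≤ eval (blockPoint n (max 2 (d / 2)) ϑ t) f) :
    ∀ y : Fin n → ℝ, 0 ≤ eval y f := by
  intro y
  obtain ⟨x, hx, hxy⟩ := exists_card_image_le_eval_le (le_max_left 2 (d / 2)) hsym
    (by have := le_max_right 2 (d / 2); omega) y
  obtain ⟨ϑ, hϑ, hsum, t, σ, hσ⟩ := exists_blockPoint_eq_comp_perm hx
  refine le_trans ?_ hxy
  have h := hpart ϑ hϑ hsum t
  rwa [hσ, ← eval_rename, hsym σ] at h
end
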